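/- arXiv:1206.6690 — 2 statements merged into one kernel-verified Lean document; each statement's English description precedes it below -/
import Mathlib

section
/- There exists a snark on 26 vertices in which every 2-factor consists only of cycles of odd length. In particular, the conjecture of Abreu, Labbate and Sheehan that the only snarks with this property are the Petersen graph (10 vertices), the Blanuša-2 snark (18 vertices) and the Flower snarks (4k vertices, k odd) is false. -/
open scoped Classical

namespace SnarkPaper

variable {V : Type*}

/-- A graph is cubic if every vertex has exactly 3 neighbours. -/
def IsCubic (G : SimpleGraph V) : Prop := ∀ v : V, (G.neighborSet v).ncard = 3

/-- A proper 3-edge-colouring: edges sharing an endpoint get different colours. -/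
def Colourable3 (G : SimpleGraph V) : Prop :=
  ∃ c : Sym2 V → Fin 3, ∀ e₁ ∈ G.edgeSet, ∀ e₂ ∈ G.edgeSet,
    e₁ ≠ e₂ → (∃ v, v ∈ e₁ ∧ v ∈ e₂) → c e₁ ≠ c e₂

/-- A subgraph is 2-regular if every one of its vertices has exactly two neighbours in it. -/
def IsTwoRegular {G : SimpleGraph V} (H : G.Subgraph) : Prop :=
  ∀ v ∈ H.verts, (H.neighborSet v).ncard = 2

/-- A cycle is a connected 2-regular subgraph. -/
def IsCycleSub {G : SimpleGraph V} (C : G.Subgraph) : Prop :=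
  C.Connected ∧ IsTwoRegular C

/-- A 2-factor is a spanning 2-regular subgraph. -/
def IsTwoFactor {G : SimpleGraph V} (F : G.Subgraph) : Prop :=
  F.IsSpanning ∧ IsTwoRegular F

/-- A 2-factor is even if all its cycles (connected components) have even length. -/
def IsEvenTwoFactor {G : SimpleGraph V} (F : G.Subgraph) : Prop :=
  IsTwoFactor F ∧ ∀ C : G.Subgraph, C ≤ F → IsCycleSub C → Even C.verts.ncard

/-- An even subgraph: every vertex has even degree. -/
def IsEvenSubgraph {G : SimpleGraph V} (H : G.Subgraph) : Prop :=
  ∀ v : V, Even (H.neighborSet v).ncard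

/-- A cycle double cover: a multiset of cycles covering each edge exactly twice. -/
def IsCDC (G : SimpleGraph V) (D : Multiset G.Subgraph) : Prop :=
  (∀ C ∈ D, IsCycleSub C) ∧
  ∀ e ∈ G.edgeSet, D.countP (fun C => e ∈ C.edgeSet) = 2

/-- A k-CDC, seen as a multiset of k even subgraphs covering each edge exactly twice. -/
def IsKCDC (G : SimpleGraph V) (k : ℕ) (D : Multiset G.Subgraph) : Prop :=
  D.card = k ∧ (∀ H ∈ D, IsEvenSubgraph H) ∧
  ∀ e ∈ G.edgeSet, D.countP (fun H => e ∈ H.edgeSet) = 2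

/-- An edge set is even if every vertex meets an even number of its edges. -/
def EvenEdgeSet (S : Set (Sym2 V)) : Prop :=
  ∀ v : V, Even {w : V | s(v, w) ∈ S}.ncard

/-- A k-CDC presented as a multiset of k even edge sets covering each edge exactly twice. -/
def IsKCDCEdgeSets (G : SimpleGraph V) (k : ℕ) (D : Multiset (Set (Sym2 V))) : Prop :=
  D.card = k ∧ (∀ S ∈ D, S ⊆ G.edgeSet ∧ EvenEdgeSet S) ∧
  ∀ e ∈ G.edgeSet, D.countP (fun S => e ∈ S) = 2

/-- The set A contains (the vertices of) a cycle of G. -/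
def HasCycleIn (G : SimpleGraph V) (A : Set V) : Prop :=
  ∃ C : G.Subgraph, IsCycleSub C ∧ C.verts ⊆ A

/-- The edges of G crossing between A and its complement. -/
def cutEdges (G : SimpleGraph V) (A : Set V) : Set (Sym2 V) :=
  {e ∈ G.edgeSet | ∃ x ∈ A, ∃ y ∉ A, e = s(x, y)}

/-- Cyclically k-edge-connected: every edge cut separating two cycles has at least k edges. -/
def CyclEdgeConn (G : SimpleGraph V) (k : ℕ) : Prop :=
  ∀ A : Set V, HasCycleIn G A → HasCycleIn G Aᶜ → k ≤ (cutEdges G A).ncard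

/-- A snark: an uncolourable cyclically 4-edge-connected cubic graph with girth at least 5. -/
def IsSnark (G : SimpleGraph V) : Prop :=
  IsCubic G ∧ ¬ Colourable3 G ∧ CyclEdgeConn G 4 ∧ 5 ≤ G.girth

/-- The edge-insertion operation applied to the edges ab and cd of G: subdivide each with a
new vertex (u = inr 0, v = inr 1) and join the two new vertices by an edge. -/
def edgeInsertion (G : SimpleGraph V) (a b c d : V) : SimpleGraph (V ⊕ Fin 2) :=
  SimpleGraph.fromEdgeSet
    ((Sym2.map Sum.inl '' (G.edgeSet \ {s(a, b), s(c, d)})) ∪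
      {s(Sum.inl a, Sum.inr 0), s(Sum.inr 0, Sum.inl b),
       s(Sum.inl c, Sum.inr 1), s(Sum.inr 1, Sum.inl d),
       s(Sum.inr 0, Sum.inr 1)})

/-- A permutation graph: a cubic graph with a 2-factor consisting of two induced cycles. -/
def IsPermutationGraph (G : SimpleGraph V) : Prop :=
  IsCubic G ∧ ∃ C₁ C₂ : G.Subgraph, IsCycleSub C₁ ∧ IsCycleSub C₂ ∧
    C₁.IsInduced ∧ C₂.IsInduced ∧ Disjoint C₁.verts C₂.verts ∧ IsTwoFactor (C₁ ⊔ C₂)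

/-- The total weight of the edge cut determined by A. -/
noncomputable def cutWeight (G : SimpleGraph V) (w : Sym2 V → ℕ) (A : Set V) : ℕ :=
  ∑ᶠ e ∈ cutEdges G A, w e

/-- An eulerian (1,2)-weight: each edge gets weight 1 or 2 and every edge cut has even weight. -/
def IsEulerianWeight (G : SimpleGraph V) (w : Sym2 V → ℕ) : Prop :=
  (∀ e ∈ G.edgeSet, w e = 1 ∨ w e = 2) ∧ ∀ A : Set V, Even (cutWeight G w A)

/-- A compatible cycle cover of (G, w): each edge e lies in exactly w(e) of the cycles. -/
def IsCompatibleCycleCover (G : SimpleGraph V) (w : Sym2 V → ℕ)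
    (D : Multiset G.Subgraph) : Prop :=
  (∀ C ∈ D, IsCycleSub C) ∧
  ∀ e ∈ G.edgeSet, D.countP (fun C => e ∈ C.edgeSet) = w e


/-- The 39 edges of the graph. -/
def snE : List (ℕ × ℕ) :=
  [(0, 1), (0, 2), (1, 3), (2, 4), (3, 4), (3, 5), (2, 6), (5, 6), (4, 7), (5, 8), (7, 8), (1,
   9), (7, 9), (8, 10), (6, 11), (10, 12), (11, 12), (12, 13), (9, 14), (13, 14), (0, 15), (13,
   15), (14, 16), (15, 17), (16, 18), (17, 18), (11, 19), (16, 20), (19, 20), (10, 21), (17,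
   22), (21, 22), (20, 23), (22, 23), (18, 24), (23, 24), (19, 25), (21, 25), (24, 25)]

/-- The three neighbours of each vertex. -/
def snN : List (ℕ × ℕ × ℕ) :=
  [(1, 2, 15), (0, 3, 9), (0, 4, 6), (1, 4, 5), (2, 3, 7), (3, 6, 8), (2, 5, 11), (4, 8, 9), (5,
   7, 10), (1, 7, 14), (8, 12, 21), (6, 12, 19), (10, 11, 13), (12, 14, 15), (9, 13, 16), (0,
   13, 17), (14, 18, 20), (15, 18, 22), (16, 17, 24), (11, 20, 25), (16, 19, 23), (10, 22, 25),
   (17, 21, 23), (20, 22, 24), (18, 23, 25), (19, 21, 24)]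

/-- Entry `k`: the vertices (with their three edges) whose last edge is number `k - 1`. -/
def snT : List (List (ℕ × ℕ × ℕ × ℕ)) :=
  [[], [], [], [], [], [], [(3, 2, 4, 5)], [(2, 1, 3, 6)], [], [(4, 3, 4, 8)], [(5, 5, 7, 9)],
   [], [(1, 0, 2, 11)], [(7, 8, 10, 12)], [(8, 9, 10, 13)], [(6, 6, 7, 14)], [], [], [(12, 15,
   16, 17)], [(9, 11, 12, 18)], [], [(0, 0, 1, 20)], [(13, 17, 19, 21)], [(14, 18, 19, 22)],
   [(15, 20, 21, 23)], [], [], [(11, 14, 16, 26)], [(16, 22, 24, 27)], [], [(10, 13, 15, 29)],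
   [(17, 23, 25, 30)], [], [(20, 27, 28, 32)], [(22, 30, 31, 33)], [(18, 24, 25, 34)], [(23, 32,
   33, 35)], [(19, 26, 28, 36)], [(21, 29, 31, 37)], [(24, 34, 35, 38), (25, 36, 37, 38)]]

/-- Entry `2 * e + 2`: the pairs of doubled indices of adjacent edges `d < e`. -/
def snC : List (List (ℕ × ℕ)) :=
  [[], [], [], [], [(0, 2)], [], [(0, 4)], [], [(2, 6)], [], [(4, 8), (6, 8)], [], [(4, 10), (8,
   10)], [], [(2, 12), (6, 12)], [], [(10, 14), (12, 14)], [], [(6, 16), (8, 16)], [], [(10,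
   18), (14, 18)], [], [(16, 20), (18, 20)], [], [(0, 22), (4, 22)], [], [(16, 24), (20, 24),
   (22, 24)], [], [(18, 26), (20, 26)], [], [(12, 28), (14, 28)], [], [(26, 30)], [], [(28, 32),
   (30, 32)], [], [(30, 34), (32, 34)], [], [(22, 36), (24, 36)], [], [(34, 38), (36, 38)], [],
   [(0, 40), (2, 40)], [], [(34, 42), (38, 42), (40, 42)], [], [(36, 44), (38, 44)], [], [(40,
   46), (42, 46)], [], [(44, 48)], [], [(46, 50), (48, 50)], [], [(28, 52), (32, 52)], [], [(44,
   54), (48, 54)], [], [(52, 56), (54, 56)], [], [(26, 58), (30, 58)], [], [(46, 60), (50, 60)],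
   [], [(58, 62), (60, 62)], [], [(54, 64), (56, 64)], [], [(60, 66), (62, 66), (64, 66)], [],
   [(48, 68), (50, 68)], [], [(64, 70), (66, 70), (68, 70)], [], [(52, 72), (56, 72)], [], [(58,
   74), (62, 74), (72, 74)], [], [(68, 76), (70, 76), (72, 76), (74, 76)]]

/-- Binary search tree over bit masks, pruned by `ok`, checking `fin` at the leaves. -/
def srch (ok : ℕ → ℕ → Bool) (fin : ℕ → Bool) : ℕ → ℕ → ℕ → Bool
  | 0, k, m => !(ok k m) || fin m
  | n + 1, k, m => !(ok k m) || (srch ok fin n (k + 1) m && srch ok fin n (k + 1) (m + 2 ^ k))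

def okCut (k m : ℕ) : Bool :=
  Nat.ble (snE.countP fun e => Nat.blt e.2 k && (Nat.testBit m e.1 != Nat.testBit m e.2)) 3

def finCut (m : ℕ) : Bool :=
  (List.range 26).any fun i =>
    ((List.range 26).all fun j => Nat.beq i j || !(Nat.testBit m j)) ||
    ((List.range 26).all fun j => Nat.beq i j || Nat.testBit m j)

def exTwo (a b c : Bool) : Bool := (a && (b ^^ c)) || (!a && b && c)

def okFac (k m : ℕ) : Bool :=
  (snT.getD k []).all fun t =>
    exTwo (Nat.testBit m t.2.1) (Nat.testBit m t.2.2.1) (Nat.testBit m t.2.2.2)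

def passE (m : ℕ) : List (ℕ × ℕ) → ℕ → ℕ → ℕ
  | [], _, S => S
  | e :: l, i, S =>
    bif Nat.testBit m i && (Nat.testBit S e.1 || Nat.testBit S e.2) then
      passE m l (i + 1) (S ||| (2 ^ e.1 ||| 2 ^ e.2))
    else passE m l (i + 1) S

def compE (m : ℕ) : ℕ → ℕ → ℕ
  | 0, S => S
  | n + 1, S => compE m n (passE m snE 0 S)

def closedE (m S : ℕ) : List (ℕ × ℕ) → ℕ → Bool
  | [], _ => true
  | e :: l, i =>
    (!(Nat.testBit m i) || (Nat.testBit S e.1 == Nat.testBit S e.2)) && closedE m S l (i + 1)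

def oddS (S : ℕ) : Bool := Nat.beq (((List.range 26).countP fun i => Nat.testBit S i) % 2) 1

def coverE (m : ℕ) : List ℕ → ℕ → Bool
  | [], _ => true
  | v :: l, cov =>
    bif Nat.testBit cov v then coverE m l cov
    else closedE m (compE m 7 (2 ^ v)) snE 0 && oddS (compE m 7 (2 ^ v)) &&
      coverE m l (cov ||| compE m 7 (2 ^ v))

def finFac (m : ℕ) : Bool := coverE m (List.range 26) 0

def okCol (k m : ℕ) : Bool :=
  (!(Nat.blt 1 k && Nat.beq (k % 2) 0 && Nat.testBit m (k - 2) &&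
    Nat.testBit m (k - 1))) &&
  (snC.getD k []).all fun t =>
    !((Nat.testBit m t.1 == Nat.testBit m t.2) &&
      (Nat.testBit m (t.1 + 1) == Nat.testBit m (t.2 + 1)))

theorem srch_cut : srch okCut finCut 26 0 0 = true := by decide +kernel

theorem srch_fac : srch okFac finFac 39 0 0 = true := by decide +kernel

theorem srch_col : srch okCol (fun _ => false) 78 0 0 = true := by decide +kernel

theorem srch_sound (ok : ℕ → ℕ → Bool) (fin : ℕ → Bool) (M N : ℕ) (hM : M < 2 ^ N)
    (hok : ∀ j ≤ N, ok j (M % 2 ^ j) = true) :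
    ∀ n k, n + k = N → srch ok fin n k (M % 2 ^ k) = true → fin M = true := by
  intro n
  induction n with
  | zero =>
    intro k hk h
    have hk' : k = N := by omega
    subst hk'
    have h1 := hok k le_rfl
    rw [Nat.mod_eq_of_lt hM] at h h1
    simpa [srch, h1] using h
  | succ n ih =>
    intro k hk h
    have h1 := hok k (by omega)
    simp only [srch, h1, Bool.not_true, Bool.false_or, Bool.and_eq_true] at h
    apply ih (k + 1) (by omega)
    have h2 : M % 2 ^ (k + 1) = M % 2 ^ k + 2 ^ k * (M / 2 ^ k % 2) := by
      rw [pow_succ, Nat.mod_mul]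
    rcases Nat.mod_two_eq_zero_or_one (M / 2 ^ k) with h3 | h3
    · rw [h2, h3]; simpa using h.1
    · rw [h2, h3]; simpa using h.2

theorem srch_main (ok : ℕ → ℕ → Bool) (fin : ℕ → Bool) (N : ℕ) (f : Fin N → Bool)
    (hs : srch ok fin N 0 0 = true)
    (hok : ∀ j ≤ N, ∀ m, (∀ i (h : i < N), i < j → m.testBit i = f ⟨i, h⟩) → ok j m = true) :
    ∃ M, (∀ i (h : i < N), M.testBit i = f ⟨i, h⟩) ∧ fin M = true := by
  refine ⟨Nat.ofBits f, fun i h => Nat.testBit_ofBits_lt f i h, ?_⟩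
  apply srch_sound ok fin _ N (Nat.ofBits_lt_two_pow f) _ N 0 rfl
  · simpa [Nat.mod_one] using hs
  · intro j hj
    apply hok j hj
    intro i h hij
    rw [Nat.testBit_mod_two_pow]
    simp [hij, Nat.testBit_ofBits_lt f i h]

/-- The vertex with a given number. -/
def vx (i : ℕ) : Fin 26 := Fin.ofNat 26 i

/-- Endpoints of edge number `i`. -/
def vA (i : ℕ) : Fin 26 := vx (snE.getD i (0, 0)).1
def vB (i : ℕ) : Fin 26 := vx (snE.getD i (0, 0)).2

def nA (v : Fin 26) : Fin 26 := vx (snN.getD v.1 (0, 0, 0)).1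
def nB (v : Fin 26) : Fin 26 := vx (snN.getD v.1 (0, 0, 0)).2.1
def nC (v : Fin 26) : Fin 26 := vx (snN.getD v.1 (0, 0, 0)).2.2

def adjB (u v : Fin 26) : Bool := nA u == v || nB u == v || nC u == v

/-- The snark. -/
def snG : SimpleGraph (Fin 26) where
  Adj u v := adjB u v = true
  symm := ⟨by decide +kernel⟩
  loopless := ⟨by decide +kernel⟩

theorem snG_adj (u v : Fin 26) : snG.Adj u v ↔ (v = nA u ∨ v = nB u ∨ v = nC u) := by
  change adjB u v = true ↔ _
  simp only [adjB, Bool.or_eq_true, beq_iff_eq, or_assoc]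
  rw [eq_comm, @eq_comm _ (nB u), @eq_comm _ (nC u)]

theorem snN_ne : ∀ v, nA v ≠ nB v ∧ nA v ≠ nC v ∧ nB v ≠ nC v := by decide +kernel

theorem snE_adjB : ∀ i < 39, adjB (vA i) (vB i) = true := by decide +kernel

theorem snE_adj (i : ℕ) (hi : i < 39) : snG.Adj (vA i) (vB i) := snE_adjB i hi

/-- Edge number of an edge. -/
def eIx (u v : Fin 26) : ℕ :=
  snE.findIdx fun e => (e.1 == u.1 && e.2 == v.1) || (e.1 == v.1 && e.2 == u.1)

theorem eIx_aux : ∀ u : Fin 26, ∀ v ∈ [nA u, nB u, nC u], eIx u v < 39 ∧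
    ((vA (eIx u v) = u ∧ vB (eIx u v) = v) ∨ (vA (eIx u v) = v ∧ vB (eIx u v) = u)) := by
  decide +kernel

theorem adj_edge {u v : Fin 26} (h : snG.Adj u v) :
    ∃ i < 39, (vA i = u ∧ vB i = v) ∨ (vA i = v ∧ vB i = u) := by
  have := eIx_aux u v (by rw [snG_adj] at h; simpa using h)
  exact ⟨_, this.1, this.2⟩

theorem nbrSet_eq (v : Fin 26) : snG.neighborSet v = {nA v, nB v, nC v} := by
  ext w; simp [snG_adj]

theorem snG_cubic : IsCubic snG := by
  intro v
  obtain ⟨h1, h2, h3⟩ := snN_ne v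
  rw [nbrSet_eq, Set.ncard_eq_three]
  exact ⟨_, _, _, h1, h2, h3, rfl⟩

theorem no_tri_aux : ∀ u : Fin 26, ∀ v ∈ [nA u, nB u, nC u], ∀ w ∈ [nA v, nB v, nC v],
    adjB w u = false := by decide +kernel

theorem no_sq_aux : ∀ u : Fin 26, ∀ v ∈ [nA u, nB u, nC u], ∀ w ∈ [nA u, nB u, nC u],
    v ≠ w → ∀ x ∈ [nA v, nB v, nC v], x ≠ u → adjB x w = false := by decide +kernel

theorem mem_of_adj {u v : Fin 26} (h : snG.Adj u v) : v ∈ [nA u, nB u, nC u] := by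
  rw [snG_adj] at h; simpa using h

theorem no_tri {a b c : Fin 26} (h1 : snG.Adj a b) (h2 : snG.Adj b c) (h3 : snG.Adj c a) :
    False := by
  have := no_tri_aux a b (mem_of_adj h1) c (mem_of_adj h2)
  have h3' : adjB c a = true := h3
  simp [this] at h3'

theorem no_sq {a b c d : Fin 26} (h1 : snG.Adj a b) (h2 : snG.Adj b c) (h3 : snG.Adj c d)
    (h4 : snG.Adj d a) (hbd : b ≠ d) (hac : c ≠ a) : False := by
  have := no_sq_aux a b (mem_of_adj h1) d (mem_of_adj h4.symm) hbd c (mem_of_adj h2) hac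
  have h3' : adjB c d = true := h3
  simp [this] at h3'

theorem snG_cyc : ∃ w : snG.Walk 0 0, w.IsCycle := by
  have h1 : snG.Adj 0 1 := by change adjB _ _ = true; decide +kernel
  have h2 : snG.Adj 1 3 := by change adjB _ _ = true; decide +kernel
  have h3 : snG.Adj 3 4 := by change adjB _ _ = true; decide +kernel
  have h4 : snG.Adj 4 2 := by change adjB _ _ = true; decide +kernel
  have h5 : snG.Adj 2 0 := by change adjB _ _ = true; decide +kernel
  refine ⟨.cons h1 (.cons h2 (.cons h3 (.cons h4 (.cons h5 .nil)))), ?_⟩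
  rw [SimpleGraph.Walk.cons_isCycle_iff]
  constructor
  · rw [SimpleGraph.Walk.isPath_def]; simp
  · simp

theorem snG_girth : 5 ≤ snG.girth := by
  have hac : ¬ snG.IsAcyclic := fun h => by
    obtain ⟨w, hw⟩ := snG_cyc
    exact h w hw
  obtain ⟨a, w, hw, hl⟩ := SimpleGraph.exists_girth_eq_length.2 hac
  rw [hl]
  have hl3 := hw.three_le_length
  by_contra hlt
  have hn := hw.support_nodup
  cases w with
  | nil => simp at hl3
  | cons h1 w =>
  cases w with
  | nil => simp at hl3
  | cons h2 w =>
  cases w with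
  | nil => simp at hl3
  | cons h3 w =>
  cases w with
  | nil => exact no_tri h1 h2 h3
  | cons h4 w =>
  cases w with
  | nil =>
    simp only [SimpleGraph.Walk.support_cons, SimpleGraph.Walk.support_nil, List.tail_cons,
      List.nodup_cons, List.mem_cons, not_or] at hn
    exact no_sq h1 h2 h3 h4 hn.1.2.1 hn.2.1.2.1
  | cons h5 w => simp at hlt

theorem cycle_three {C : snG.Subgraph} (hC : IsCycleSub C) (i : Fin 26) :
    ∃ j ∈ C.verts, j ≠ i := by
  obtain ⟨v, hv⟩ := hC.1.nonempty
  by_cases h : v = i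
  · have h2 := hC.2 v hv
    obtain ⟨w, hw⟩ : (C.neighborSet v).Nonempty := by
      rw [← Set.ncard_pos (Set.toFinite _)]; omega
    have hw' : C.Adj v w := hw
    exact ⟨w, hw'.snd_mem, fun e => hw'.ne (by rw [h, e])⟩
  · exact ⟨v, hv, h⟩

def edgeS (e : ℕ × ℕ) : Sym2 (Fin 26) := s(vx e.1, vx e.2)

theorem snE_lt : ∀ e ∈ snE, e.1 < 26 ∧ e.2 < 26 ∧ e.1 < e.2 ∧
    adjB (vx e.1) (vx e.2) = true := by decide +kernel

theorem snE_nodup : snE.Nodup := by decide +kernel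

theorem vx_val (i : Fin 26) : vx i.1 = i := by
  simp [vx]

theorem vx_inj {a b : ℕ} (ha : a < 26) (hb : b < 26) (h : vx a = vx b) : a = b := by
  have := congrArg Fin.val h
  simpa [vx, Fin.ofNat, Nat.mod_eq_of_lt ha, Nat.mod_eq_of_lt hb] using this

theorem edgeS_nodup : (snE.map edgeS).Nodup := by
  refine List.Nodup.map_on ?_ snE_nodup
  intro x hx y hy h
  obtain ⟨x1, x2, x3, -⟩ := snE_lt x hx
  obtain ⟨y1, y2, y3, -⟩ := snE_lt y hy
  rcases Sym2.eq_iff.1 h with ⟨h1, h2⟩ | ⟨h1, h2⟩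
  · exact Prod.ext (vx_inj x1 y1 h1) (vx_inj x2 y2 h2)
  · have := vx_inj x1 y2 h1
    have := vx_inj x2 y1 h2
    omega

theorem cut_count (A : Set (Fin 26)) (p : ℕ × ℕ → Bool)
    (hp : ∀ e ∈ snE, p e = true → ¬ (vx e.1 ∈ A ↔ vx e.2 ∈ A)) :
    snE.countP p ≤ (cutEdges snG A).ncard := by
  have hnd : ((snE.filter p).map edgeS).Nodup :=
    edgeS_nodup.sublist (List.filter_sublist.map _)
  have h1 : (((snE.filter p).map edgeS).toFinset : Set (Sym2 (Fin 26))) ⊆ cutEdges snG A := by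
    intro s hs
    simp only [List.coe_toFinset, Set.mem_ofPred_eq, List.mem_map, List.mem_filter] at hs
    obtain ⟨e, ⟨he, hpe⟩, rfl⟩ := hs
    have had : snG.Adj (vx e.1) (vx e.2) := (snE_lt e he).2.2.2
    have := hp e he hpe
    refine ⟨had, ?_⟩
    by_cases h : vx e.1 ∈ A
    · exact ⟨_, h, _, fun h' => this ⟨fun _ => h', fun _ => h⟩, rfl⟩
    · refine ⟨vx e.2, ?_, _, h, Sym2.eq_swap⟩
      by_contra h'
      exact this ⟨fun x => absurd x h, fun x => absurd x h'⟩
  have h2 := Set.ncard_le_ncard h1 (Set.toFinite _)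
  rw [Set.ncard_coe_finset, List.toFinset_card_of_nodup hnd, List.length_map,
    ← List.countP_eq_length_filter] at h2
  exact h2

theorem snG_cyclConn : CyclEdgeConn snG 4 := by
  intro A hA hB
  by_contra hlt
  obtain ⟨M, hM, hfin⟩ := srch_main okCut finCut 26 (fun i => decide (i ∈ A)) srch_cut (by
    intro j hj m hm
    unfold okCut
    rw [Nat.ble_eq]
    refine le_trans (cut_count A _ ?_) (by omega : (cutEdges snG A).ncard ≤ 3)
    intro e he hpe
    obtain ⟨h1, h2, h3, -⟩ := snE_lt e he
    simp only [Bool.and_eq_true, Nat.blt_eq, bne_iff_ne, ne_eq] at hpe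
    obtain ⟨h4, h5⟩ := hpe
    rw [hm _ h1 (by omega), hm _ h2 h4] at h5
    have e1 : (⟨e.1, h1⟩ : Fin 26) = vx e.1 := (vx_val ⟨e.1, h1⟩).symm
    have e2 : (⟨e.2, h2⟩ : Fin 26) = vx e.2 := (vx_val ⟨e.2, h2⟩).symm
    rw [e1, e2] at h5
    simpa using h5)
  obtain ⟨C, hC, hCA⟩ := hA
  obtain ⟨D, hD, hDA⟩ := hB
  simp only [finCut, List.any_eq_true, List.mem_range, Bool.or_eq_true, List.all_eq_true,
    Nat.beq_eq, Bool.not_eq_true'] at hfin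
  obtain ⟨i, hi, h | h⟩ := hfin
  · obtain ⟨j, hj, hne⟩ := cycle_three hC ⟨i, hi⟩
    rcases h j.1 j.2 with h | h
    · exact hne (Fin.ext h.symm)
    · rw [hM _ j.2] at h
      exact (of_decide_eq_false h) (hCA hj)
  · obtain ⟨j, hj, hne⟩ := cycle_three hD ⟨i, hi⟩
    rcases h j.1 j.2 with h | h
    · exact hne (Fin.ext h.symm)
    · rw [hM _ j.2] at h
      exact (hDA hj) (of_decide_eq_true h)

theorem snC_check : ∀ k < 79, ∀ t ∈ snC.getD k [], t.1 % 2 = 0 ∧ t.2 % 2 = 0 ∧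
    t.1 + 1 < k ∧ t.2 + 1 < k ∧
    (s(vA (t.1 / 2), vB (t.1 / 2)) : Sym2 (Fin 26)) ≠ s(vA (t.2 / 2), vB (t.2 / 2)) ∧
    (vA (t.1 / 2) = vA (t.2 / 2) ∨ vA (t.1 / 2) = vB (t.2 / 2) ∨
     vB (t.1 / 2) = vA (t.2 / 2) ∨ vB (t.1 / 2) = vB (t.2 / 2)) := by
  simp only [ne_eq, Sym2.eq_iff]
  decide +kernel

theorem snG_uncol : ¬ Colourable3 snG := by
  rintro ⟨c, hc⟩
  let d : ℕ → Fin 3 := fun e => c s(vA e, vB e)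
  obtain ⟨M, -, hfin⟩ := srch_main okCol (fun _ => false) 78
    (fun i => bif i.1 % 2 == 0 then d (i.1 / 2) == 1 else d (i.1 / 2) == 2) srch_col (by
    intro k hk m hm
    have hev : ∀ e, 2 * e + 1 < k → m.testBit (2 * e) = (d e == 1) := by
      intro e he
      rw [hm _ (by omega) (by omega)]
      simp
    have hod : ∀ e, 2 * e + 1 < k → m.testBit (2 * e + 1) = (d e == 2) := by
      intro e he
      rw [hm _ (by omega) (by omega)]
      have h1 : (2 * e + 1) % 2 = 1 := by omega
      have h2 : (2 * e + 1) / 2 = e := by omega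
      simp [h1, h2]
    unfold okCol
    rw [Bool.and_eq_true]
    constructor
    · by_contra hcon
      simp only [Bool.not_eq_true, Bool.not_eq_false', Bool.and_eq_true, Nat.beq_eq,
        Nat.blt_eq] at hcon
      obtain ⟨⟨⟨h0, h1⟩, h2⟩, h3⟩ := hcon
      obtain ⟨e, rfl⟩ : ∃ e, k = 2 * e + 2 := ⟨k / 2 - 1, by omega⟩
      have h2' := hev e (by omega)
      have h3' := hod e (by omega)
      rw [show 2 * e + 2 - 2 = 2 * e by omega, h2'] at h2
      rw [show 2 * e + 2 - 1 = 2 * e + 1 by omega, h3'] at h3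
      rw [beq_iff_eq] at h2 h3
      rw [h2] at h3
      exact absurd h3 (by decide)
    · rw [List.all_eq_true]
      rintro ⟨p, q⟩ ht
      obtain ⟨p0, q0, pk, qk, hne, hsh⟩ := snC_check k (by omega) _ ht
      simp only at p0 q0 pk qk hne hsh ⊢
      obtain ⟨a, rfl⟩ : ∃ a, p = 2 * a := ⟨p / 2, by omega⟩
      obtain ⟨b, rfl⟩ : ∃ b, q = 2 * b := ⟨q / 2, by omega⟩
      rw [hev a pk, hev b qk, hod a pk, hod b qk]
      simp only [Nat.mul_div_cancel_left _ (by norm_num : 0 < 2)] at hne hsh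
      have hab : d a ≠ d b := by
        apply hc _ (snE_adj a (by omega)) _ (snE_adj b (by omega)) hne
        rcases hsh with h | h | h | h
        · exact ⟨vA a, by simp, by simp [h]⟩
        · exact ⟨vA a, by simp, by simp [h]⟩
        · exact ⟨vB a, by simp, by simp [h]⟩
        · exact ⟨vB a, by simp, by simp [h]⟩
      generalize d a = x at hab
      generalize d b = y at hab
      revert x y
      decide)
  exact Bool.noConfusion hfin

theorem exTwo_of_ncard {S : Set (Fin 26)} {a b c : Fin 26} (hab : a ≠ b) (hac : a ≠ c)
    (hbc : b ≠ c) (hS : S ⊆ {a, b, c}) (h2 : S.ncard = 2) :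
    exTwo (decide (a ∈ S)) (decide (b ∈ S)) (decide (c ∈ S)) = true := by
  have key : ∀ T : Finset (Fin 26), (∀ x, x ∈ S → x ∈ T) → 2 ≤ T.card := by
    intro T hT
    rw [← h2, ← Set.ncard_coe_finset]
    exact Set.ncard_le_ncard (fun x hx => hT x hx) (Set.toFinite _)
  have hmem : ∀ x ∈ S, x = a ∨ x = b ∨ x = c := fun x hx => by simpa using hS hx
  by_cases ha : a ∈ S <;> by_cases hb : b ∈ S <;> by_cases hc : c ∈ S <;>
    simp only [exTwo, ha, hb, hc, decide_true, decide_false, Bool.xor_true, Bool.xor_false,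
      Bool.not_true, Bool.not_false, Bool.and_true, Bool.and_false, Bool.or_true,
      Bool.or_false, Bool.false_and, Bool.true_and]
  · exfalso
    have : ({a, b, c} : Set (Fin 26)) ⊆ S := by
      rintro x (rfl | rfl | rfl) <;> assumption
    have h3 := Set.ncard_le_ncard this (Set.toFinite _)
    rw [Set.ncard_eq_three.2 ⟨a, b, c, hab, hac, hbc, rfl⟩] at h3
    omega
  · exfalso
    have := key {a} (fun x hx => by rcases hmem x hx with rfl | rfl | rfl <;> simp_all)
    simp at this
  · exfalso
    have := key {b} (fun x hx => by rcases hmem x hx with rfl | rfl | rfl <;> simp_all)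
    simp at this
  · exfalso
    have := key {c} (fun x hx => by rcases hmem x hx with rfl | rfl | rfl <;> simp_all)
    simp at this
  · exfalso
    have := key ∅ (fun x hx => by rcases hmem x hx with rfl | rfl | rfl <;> simp_all)
    simp at this

/-- Edge number `i` joins `u` and `v`. -/
def joins (i : ℕ) (u v : Fin 26) : Bool :=
  (vA i == u && vB i == v) || (vA i == v && vB i == u)

theorem joins_iff (i : ℕ) (u v : Fin 26) : joins i u v = true ↔
    (vA i = u ∧ vB i = v) ∨ (vA i = v ∧ vB i = u) := by
  simp [joins]

theorem snT_check : ∀ k < 40, ∀ t ∈ snT.getD k [],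
    t.2.1 < k ∧ t.2.2.1 < k ∧ t.2.2.2 < k ∧ joins t.2.1 (vx t.1) (nA (vx t.1)) = true ∧
    joins t.2.2.1 (vx t.1) (nB (vx t.1)) = true ∧
    joins t.2.2.2 (vx t.1) (nC (vx t.1)) = true := by
  decide +kernel

theorem joins_adj {F : snG.Subgraph} {i : ℕ} {u v : Fin 26} (h : joins i u v = true) :
    F.Adj (vA i) (vB i) ↔ v ∈ F.neighborSet u := by
  rw [SimpleGraph.Subgraph.mem_neighborSet]
  rcases (joins_iff _ _ _).1 h with ⟨h1, h2⟩ | ⟨h1, h2⟩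
  · rw [h1, h2]
  · rw [h1, h2, F.adj_comm]

theorem testBit_or_pows {S a b w : ℕ} (h : (S ||| (2 ^ a ||| 2 ^ b)).testBit w = true) :
    S.testBit w = true ∨ w = a ∨ w = b := by
  simp only [Nat.testBit_or, Nat.testBit_two_pow, Bool.or_eq_true, decide_eq_true_eq] at h
  tauto

/-- If `D` does not split any selected edge, then the pass only adds vertices which are in `D`
exactly when the initial ones are. -/
theorem passE_inv (m : ℕ) (D : ℕ → Prop) (P : Prop) :
    ∀ (l : List (ℕ × ℕ)) (i S : ℕ),
    (∀ j (h : j < l.length), m.testBit (i + j) = true → (D l[j].1 ↔ D l[j].2)) →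
    (∀ w, S.testBit w = true → (D w ↔ P)) →
    ∀ w, (passE m l i S).testBit w = true → (D w ↔ P) := by
  intro l
  induction l with
  | nil => intro i S _ hS w hw; exact hS w hw
  | cons e l ih =>
    intro i S hl hS w hw
    have hl' : ∀ j (h : j < l.length), m.testBit (i + 1 + j) = true →
        (D l[j].1 ↔ D l[j].2) := by
      intro j h hj
      have := hl (j + 1) (by simpa using h) (by rwa [show i + (j + 1) = i + 1 + j by omega])
      simpa using this
    unfold passE at hw
    by_cases hc : (m.testBit i && (S.testBit e.1 || S.testBit e.2)) = true
    · rw [hc, cond_true] at hw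
      refine ih (i + 1) _ hl' ?_ w hw
      simp only [Bool.and_eq_true, Bool.or_eq_true] at hc
      have he : D e.1 ↔ D e.2 := hl 0 (by simp) (by simpa using hc.1)
      have hP : D e.1 ↔ P := by
        rcases hc.2 with h | h
        · exact hS _ h
        · rw [he]; exact hS _ h
      intro x hx
      rcases testBit_or_pows hx with h | h | h
      · exact hS x h
      · rw [h]; exact hP
      · rw [h, ← he]; exact hP
    · rw [Bool.not_eq_true] at hc
      rw [hc, cond_false] at hw
      exact ih (i + 1) _ hl' hS w hw

theorem compE_inv (m : ℕ) (D : ℕ → Prop) (P : Prop)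
    (hD : ∀ j (h : j < snE.length), m.testBit j = true → (D snE[j].1 ↔ D snE[j].2)) :
    ∀ (n S : ℕ), (∀ w, S.testBit w = true → (D w ↔ P)) →
    ∀ w, (compE m n S).testBit w = true → (D w ↔ P) := by
  intro n
  induction n with
  | zero => intro S hS w hw; exact hS w hw
  | succ n ih =>
    intro S hS
    exact ih _ (passE_inv m D P snE 0 S (by simpa using hD) hS)

theorem closedE_spec (m S : ℕ) : ∀ (l : List (ℕ × ℕ)) (i : ℕ), closedE m S l i = true →
    ∀ j (h : j < l.length), m.testBit (i + j) = true →
      S.testBit l[j].1 = S.testBit l[j].2 := by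
  intro l
  induction l with
  | nil => intro i _ j h; simp at h
  | cons e l ih =>
    intro i hc j h hj
    simp only [closedE, Bool.and_eq_true, Bool.or_eq_true, Bool.not_eq_true', beq_iff_eq] at hc
    cases j with
    | zero =>
      rcases hc.1 with h1 | h1
      · simp [h1] at hj
      · simpa using h1
    | succ j =>
      simpa using ih (i + 1) hc.2 j (by simpa using h)
        (by rwa [show i + 1 + j = i + (j + 1) by omega])

theorem coverE_spec (m : ℕ) (D : ℕ → Prop) (Q : Prop)
    (hD : ∀ j (h : j < snE.length), m.testBit j = true → (D snE[j].1 ↔ D snE[j].2))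
    (hQ : ∀ S : ℕ, closedE m S snE 0 = true → oddS S = true →
      (∀ w, S.testBit w = true → D w) → (∃ v < 26, D v ∧ S.testBit v = true) → Q)
    (hne : ∀ (n v : ℕ), D v → v < 26 → (compE m n (2 ^ v)).testBit v = true) :
    ∀ (l : List ℕ) (cov : ℕ), (∀ v ∈ l, v < 26) → (∀ w, cov.testBit w = true → D w → Q) →
      coverE m l cov = true → ∀ v ∈ l, D v → Q := by
  intro l
  induction l with
  | nil => intro cov _ _ _ v hv; simp at hv
  | cons a l ih =>
    intro cov hl hcov hc v hv hDv
    unfold coverE at hc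
    by_cases ha : cov.testBit a = true
    · rw [ha, cond_true] at hc
      rcases List.mem_cons.1 hv with rfl | hv
      · exact hcov _ ha hDv
      · exact ih cov (fun x hx => hl x (by simp [hx])) hcov hc v hv hDv
    · rw [Bool.not_eq_true] at ha
      rw [ha, cond_false] at hc
      simp only [Bool.and_eq_true] at hc
      obtain ⟨⟨h1, h2⟩, h3⟩ := hc
      have hinv := compE_inv m D (D a) hD 7 (2 ^ a) (by
        intro w hw
        rw [Nat.testBit_two_pow, decide_eq_true_eq] at hw
        rw [hw])
      have haQ : D a → Q := fun hDa =>
        hQ _ h1 h2 (fun w hw => (hinv w hw).2 hDa) ⟨a, hl a (by simp), hDa, hne 7 a hDa (hl a (by simp))⟩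
      rcases List.mem_cons.1 hv with rfl | hv
      · exact haQ hDv
      · refine ih _ (fun x hx => hl x (by simp [hx])) ?_ h3 v hv hDv
        intro w hw hDw
        rw [Nat.testBit_or, Bool.or_eq_true] at hw
        rcases hw with hw | hw
        · exact hcov w hw hDw
        · exact haQ ((hinv w hw).1 hDw)

theorem passE_mono (m v : ℕ) : ∀ (l : List (ℕ × ℕ)) (i S : ℕ), S.testBit v = true →
    (passE m l i S).testBit v = true := by
  intro l
  induction l with
  | nil => intro i S h; exact h
  | cons e l ih =>
    intro i S h
    unfold passE
    cases (m.testBit i && (S.testBit e.1 || S.testBit e.2))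
    · rw [cond_false]; exact ih _ _ h
    · rw [cond_true]; exact ih _ _ (by simp [Nat.testBit_or, h])

theorem compE_mono (m v : ℕ) : ∀ (n S : ℕ), S.testBit v = true →
    (compE m n S).testBit v = true := by
  intro n
  induction n with
  | zero => intro S h; exact h
  | succ n ih => intro S h; exact ih _ (passE_mono m v _ _ _ h)

theorem snE_length : snE.length = 39 := by decide +kernel

theorem vA_eq (j : ℕ) (h : j < snE.length) : vA j = vx snE[j].1 := by
  unfold vA; rw [List.getD_eq_getElem _ _ h]

theorem vB_eq (j : ℕ) (h : j < snE.length) : vB j = vx snE[j].2 := by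
  unfold vB; rw [List.getD_eq_getElem _ _ h]

theorem oddS_spec (S : ℕ) (h : oddS S = true) (D : Set (Fin 26))
    (hD : ∀ v : Fin 26, v ∈ D ↔ S.testBit v.1 = true) : Odd D.ncard := by
  have h1 : (List.range 26).countP (fun i => Nat.testBit S i) = D.ncard := by
    have e1 : Fin.val '' D = (((List.range 26).filter fun i => Nat.testBit S i).toFinset : Set ℕ) := by
      ext w
      simp only [Set.mem_image, List.coe_toFinset, Set.mem_ofPred_eq, List.mem_filter,
        List.mem_range]
      constructor
      · rintro ⟨v, hv, rfl⟩
        exact ⟨v.2, (hD v).1 hv⟩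
      · rintro ⟨hw, hb⟩
        exact ⟨⟨w, hw⟩, (hD _).2 hb, rfl⟩
    rw [← Set.ncard_image_of_injective D Fin.val_injective, e1, Set.ncard_coe_finset,
      List.toFinset_card_of_nodup (List.nodup_range.filter _), List.countP_eq_length_filter]
  rw [oddS, Nat.beq_eq, h1] at h
  exact Nat.odd_iff.2 h

theorem closed_of_le {F C : snG.Subgraph} (hF : IsTwoFactor F) (hCF : C ≤ F)
    (hC : IsCycleSub C) {u v : Fin 26} (hu : u ∈ C.verts) (h : F.Adj u v) : C.Adj u v := by
  have h1 : C.neighborSet u ⊆ F.neighborSet u := fun w hw => hCF.2 hw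
  have h2 := Set.eq_of_subset_of_ncard_le h1
    (by rw [hC.2 u hu, hF.2 u (hF.1 u)]) (Set.toFinite _)
  have h3 : v ∈ F.neighborSet u := h
  rw [← h2] at h3
  exact h3

theorem conn_closed {C : snG.Subgraph} (hC : C.Connected) (T : Set (Fin 26))
    (hT : ∀ u v, C.Adj u v → u ∈ T → v ∈ T) {a : Fin 26} (ha : a ∈ C.verts) (haT : a ∈ T)
    {b : Fin 26} (hb : b ∈ C.verts) : b ∈ T := by
  obtain ⟨w⟩ := hC.coe.preconnected ⟨a, ha⟩ ⟨b, hb⟩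
  have : ∀ (x y : C.verts) (w : C.coe.Walk x y), x.1 ∈ T → y.1 ∈ T := by
    intro x y w
    induction w with
    | nil => exact id
    | cons h _ ih => exact fun hx => ih (hT _ _ h hx)
  exact this _ _ w haT

theorem snG_odd (F : snG.Subgraph) (hF : IsTwoFactor F) (C : snG.Subgraph) (hCF : C ≤ F)
    (hC : IsCycleSub C) : Odd C.verts.ncard := by
  obtain ⟨M, hM, hfin⟩ := srch_main okFac finFac 39
    (fun i => decide (F.Adj (vA i.1) (vB i.1))) srch_fac (by
    intro k hk m hm
    unfold okFac
    rw [List.all_eq_true]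
    intro t ht
    obtain ⟨h1, h2, h3, j1, j2, j3⟩ := snT_check k (by omega) t ht
    rw [hm _ (by omega) h1, hm _ (by omega) h2, hm _ (by omega) h3]
    simp only [joins_adj j1, joins_adj j2, joins_adj j3]
    obtain ⟨n1, n2, n3⟩ := snN_ne (vx t.1)
    apply exTwo_of_ncard n1 n2 n3 _ (hF.2 _ (hF.1 _))
    rw [← nbrSet_eq]
    exact F.neighborSet_subset _)
  obtain ⟨a, ha⟩ := hC.1.nonempty
  have hbit : ∀ j (h : j < snE.length), M.testBit j = true →
      F.Adj (vx snE[j].1) (vx snE[j].2) := by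
    intro j h hj
    rw [hM j (by rwa [snE_length] at h)] at hj
    rw [← vA_eq, ← vB_eq]
    exact of_decide_eq_true hj
  refine coverE_spec M (fun w => vx w ∈ C.verts) _ ?_ ?_ ?_ (List.range 26) 0 (by simp) (by simp)
    hfin a.1 (by simp) (by rwa [vx_val])
  · intro j h hj
    have h1 := hbit j h hj
    exact ⟨fun hx => (closed_of_le hF hCF hC hx h1).snd_mem,
      fun hx => (closed_of_le hF hCF hC hx h1.symm).snd_mem⟩
  · rintro S hcl hodd hSD ⟨b, hb, hbD, hbS⟩
    apply oddS_spec S hodd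
    intro v
    constructor
    · intro hv
      refine conn_closed hC.1 {x | S.testBit x.1 = true} ?_ hbD ?_ hv
      · intro u w huw hu
        obtain ⟨i, hi, hij⟩ := adj_edge huw.adj_sub
        have hFi : M.testBit i = true := by
          rw [hM i hi, decide_eq_true_eq]
          rcases hij with ⟨e1, e2⟩ | ⟨e1, e2⟩
          · simp only [e1, e2]; exact hCF.2 huw
          · simp only [e1, e2]; exact (hCF.2 huw).symm
        have hi' : i < snE.length := by rwa [snE_length]
        have := closedE_spec M S snE 0 hcl i hi' (by simpa using hFi)
        have hlt := snE_lt _ (List.getElem_mem hi')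
        rw [vA_eq i hi', vB_eq i hi'] at hij
        have x1 : (vx snE[i].1).1 = snE[i].1 := Nat.mod_eq_of_lt hlt.1
        have x2 : (vx snE[i].2).1 = snE[i].2 := Nat.mod_eq_of_lt hlt.2.1
        change S.testBit u.1 = true at hu
        change S.testBit w.1 = true
        rcases hij with ⟨e1, e2⟩ | ⟨e1, e2⟩
        · rw [← e2, x2, ← this, ← x1, e1]; exact hu
        · rw [← e1, x1, this, ← x2, e2]; exact hu
      · change S.testBit (vx b).1 = true
        have : (vx b).1 = b := Nat.mod_eq_of_lt hb
        rw [this]; exact hbS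
    · intro hv
      have := hSD v.1 hv
      rwa [vx_val] at this
  · intro n v _ _
    exact compE_mono M v n _ (by simp)

/-- there exists a snark on 26 vertices all of whose 2-factors consist only of
odd cycles (refuting the conjecture of Abreu, Labbate and Sheehan). -/
theorem exists_snark_26_all_two_factors_odd :
    ∃ G : SimpleGraph (Fin 26), IsSnark G ∧
      ∀ F : G.Subgraph, IsTwoFactor F →
        ∀ C : G.Subgraph, C ≤ F → IsCycleSub C → Odd C.verts.ncard :=
  ⟨snG, ⟨snG_cubic, snG_uncol, snG_cyclConn, snG_girth⟩, snG_odd⟩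

end SnarkPaper
end

section
/- There exists a cyclically 5-edge-connected snark on 34 vertices having a 2-factor that is not contained in any cycle double cover of the graph. In particular, the conjecture of Jackson that in every cyclically 5-edge-connected cubic graph other than the Petersen graph (which has 10 vertices) every set of pairwise disjoint cycles is a subset of a CDC is false. -/
open scoped Classical

namespace SnarkPaper

variable {V : Type*}

/-! ### The graph: two 17-cycles joined by a perfect matching -/

/-- Successor on the two 17-cycles. -/
def nx : Fin 34 → Fin 34 :=
  ![1, 2, 3, 4, 5, 6, 7, 8, 9, 10, 11, 12, 13, 14, 15, 16, 0, 18, 19, 20, 21, 22, 23, 24, 25,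
    26, 27, 28, 29, 30, 31, 32, 33, 17]

/-- Predecessor on the two 17-cycles. -/
def pv : Fin 34 → Fin 34 :=
  ![16, 0, 1, 2, 3, 4, 5, 6, 7, 8, 9, 10, 11, 12, 13, 14, 15, 33, 17, 18, 19, 20, 21, 22, 23,
    24, 25, 26, 27, 28, 29, 30, 31, 32]

/-- The other end of the spoke. -/
def sp : Fin 34 → Fin 34 :=
  ![17, 20, 27, 33, 26, 28, 22, 19, 21, 30, 32, 29, 23, 25, 18, 24, 31, 0, 14, 7, 1, 8, 6, 12,
    15, 13, 4, 2, 5, 11, 9, 16, 10, 3]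

/-- The spokes, as (left edge, right edge, left edge at other end, right edge at other end),
with edge `v, nx v` numbered `em v`. -/
def spokeList : List (ℕ × ℕ × ℕ × ℕ) :=
  [(12, 13, 26, 27), (11, 12, 24, 25), (14, 15, 25, 26), (9, 10, 33, 34), (8, 9, 31, 32), (10,
    11, 30, 31), (15, 16, 32, 33), (7, 8, 22, 23), (5, 6, 23, 24), (6, 7, 20, 21), (13, 14, 19, 20),
    (16, 0, 35, 19), (0, 1, 21, 22), (4, 5, 29, 30), (1, 2, 28, 29), (3, 4, 27, 28), (2, 3, 34, 35)]

/-- Vertices in search order, each with its earlier neighbours. -/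
def stepList : List (ℕ × List ℕ) :=
  [(9, []), (8, [9]), (10, [9]), (30, [9]), (7, [8]), (21, [8]), (11, [10]), (29, [30, 11]),
    (32, [10]), (31, [32, 30]), (6, [7]), (22, [21, 6]), (19, [7]), (20, [21, 19]), (12, [11]), (23,
    [22, 12]), (28, [29]), (5, [6, 28]), (33, [32]), (16, [31]), (18, [19]), (17, [18, 33]), (0,
    [16, 17]), (1, [0, 20]), (13, [12]), (14, [13, 18]), (15, [16, 14]), (24, [23, 15]), (25, [24,
    13]), (27, [28]), (2, [1, 27]), (3, [2, 33]), (4, [5, 3]), (26, [27, 25, 4])]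

theorem pv_nx : ∀ v, pv (nx v) = v := by decide
theorem nx_pv : ∀ v, nx (pv v) = v := by decide
theorem sp_sp : ∀ v, sp (sp v) = v := by decide
theorem nx_ne : ∀ v, nx v ≠ v := by decide
theorem pv_ne : ∀ v, pv v ≠ v := by decide
theorem sp_ne : ∀ v, sp v ≠ v := by decide
theorem nx_ne_pv : ∀ v, nx v ≠ pv v := by decide
theorem nx_ne_sp : ∀ v, nx v ≠ sp v := by decide
theorem pv_ne_sp : ∀ v, pv v ≠ sp v := by decide
theorem nx_nx_ne : ∀ v, nx (nx v) ≠ v := by decide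

/-- The snark. -/
def snk : SimpleGraph (Fin 34) where
  Adj a b := b = nx a ∨ b = pv a ∨ b = sp a
  symm := ⟨by
    rintro a b (h | h | h)
    · right; left; rw [h, pv_nx]
    · left; rw [h, nx_pv]
    · right; right; rw [h, sp_sp]⟩
  loopless := ⟨by
    rintro a (h | h | h)
    · exact nx_ne a h.symm
    · exact pv_ne a h.symm
    · exact sp_ne a h.symm⟩

theorem snk_adj (a b : Fin 34) : snk.Adj a b ↔ b = nx a ∨ b = pv a ∨ b = sp a := Iff.rfl

theorem ncard_three {α : Type*} {a b c : α} (h1 : a ≠ b) (h2 : a ≠ c) (h3 : b ≠ c) :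
    ({a, b, c} : Set α).ncard = 3 := by
  rw [Set.ncard_eq_toFinset_card']
  simp [h1, h2, h3]

theorem snk_cubic : IsCubic snk := by
  intro v
  have : snk.neighborSet v = {nx v, pv v, sp v} := by
    ext w
    simp [snk_adj]
  rw [this]
  exact ncard_three (nx_ne_pv v) (nx_ne_sp v) (pv_ne_sp v)

/-! ### The labelling search -/

/-- Replace the label of `b` by that of `a`. -/
def mergeL (d : List ℕ) (a b : ℕ) : List ℕ :=
  d.map fun x => bif Nat.beq x (d.getD b 0) then d.getD a 0 else x

/-- Two consecutive entries are equal. -/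
def badL : List ℕ → Bool
  | [] => false
  | a :: t =>
    match t with
    | [] => false
    | b :: _ => Nat.beq a b || badL t

/-- Depth-first refutation search. -/
def refute : List (ℕ × ℕ × ℕ × ℕ) → List ℕ → Bool
  | [], _ => false
  | (l, r, m, n) :: t, d =>
    (let e := mergeL (mergeL d l m) r n
     badL e || refute t e) &&
    (let e := mergeL (mergeL d l n) r m
     badL e || refute t e)

/-- Initial labels: each 17-cycle of edges is closed up, and 18 is a separator. -/
def initL : List ℕ :=
  [0, 1, 2, 3, 4, 5, 6, 7, 8, 9, 10, 11, 12, 13, 14, 15, 16, 0, 18,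
   19, 20, 21, 22, 23, 24, 25, 26, 27, 28, 29, 30, 31, 32, 33, 34, 35, 19]

theorem refute_true : refute spokeList initL = true := by decide +kernel

/-- The label representation invariant. -/
def RepInv {α : Type*} (f : ℕ → α) (d : List ℕ) : Prop :=
  d.length = 37 ∧ ∀ p < 37, f (d.getD p 0) = f p

theorem RepInv.merge {α : Type*} {f : ℕ → α} {d : List ℕ} (h : RepInv f d) {a b : ℕ}
    (ha : a < 37) (hb : b < 37) (hab : f a = f b) : RepInv f (mergeL d a b) := by
  refine ⟨by simp [mergeL, h.1], fun p hp => ?_⟩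
  have e : (mergeL d a b).getD p 0 =
      bif Nat.beq (d.getD p 0) (d.getD b 0) then d.getD a 0 else d.getD p 0 := by
    have hp2 : p < d.length := by rw [h.1]; exact hp
    simp [mergeL, List.getD_eq_getElem?_getD, hp2]
  rw [e]
  cases hc : Nat.beq (d.getD p 0) (d.getD b 0)
  · exact h.2 p hp
  · have := Nat.eq_of_beq_eq_true hc
    rw [cond_true, h.2 a ha, hab, ← h.2 b hb, ← this, h.2 p hp]

theorem badL_ex (d : List ℕ) (h : badL d = true) :
    ∃ p, p + 1 < d.length ∧ d.getD p 0 = d.getD (p + 1) 0 := by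
  induction d with
  | nil => simp [badL] at h
  | cons a t ih =>
    cases t with
    | nil => simp [badL] at h
    | cons b t =>
      rw [badL] at h
      simp only [Bool.or_eq_true] at h
      rcases h with h | h
      · exact ⟨0, by simp, by simpa using Nat.eq_of_beq_eq_true h⟩
      · obtain ⟨p, hp, he⟩ := ih h
        exact ⟨p + 1, by simpa using hp, by simpa using he⟩

theorem badL_sound {α : Type*} {f : ℕ → α} {d : List ℕ} (h : RepInv f d)
    (hf : ∀ p < 36, f p ≠ f (p + 1)) : badL d = false := by
  rw [← Bool.not_eq_true]
  intro hb
  obtain ⟨p, hp, he⟩ := badL_ex d hb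
  rw [h.1] at hp
  apply hf p (by omega)
  rw [← h.2 p (by omega), ← h.2 (p + 1) hp, he]

theorem refute_sound {α : Type*} {f : ℕ → α} (hf : ∀ p < 36, f p ≠ f (p + 1))
    (t : List (ℕ × ℕ × ℕ × ℕ))
    (hs : ∀ q ∈ t, q.1 < 37 ∧ q.2.1 < 37 ∧ q.2.2.1 < 37 ∧ q.2.2.2 < 37)
    (ht : ∀ q ∈ t, (f q.1 = f q.2.2.1 ∧ f q.2.1 = f q.2.2.2) ∨
      (f q.1 = f q.2.2.2 ∧ f q.2.1 = f q.2.2.1))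
    (d : List ℕ) (h : RepInv f d) : refute t d = false := by
  induction t generalizing d with
  | nil => rfl
  | cons q t ih =>
    have ih := ih (fun q hq => hs q (List.mem_cons_of_mem _ hq))
      (fun q hq => ht q (List.mem_cons_of_mem _ hq))
    obtain ⟨h1, h2, h3, h4⟩ := hs _ (List.mem_cons_self ..)
    have hq := ht _ (List.mem_cons_self ..)
    obtain ⟨l, r, m, n⟩ := q
    simp only at h1 h2 h3 h4 hq
    rw [refute, Bool.and_eq_false_iff]
    rcases hq with ⟨e1, e2⟩ | ⟨e1, e2⟩
    · left
      have hi := (h.merge h1 h3 e1).merge h2 h4 e2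
      simp only [badL_sound hi hf, ih _ hi, Bool.or_false]
    · right
      have hi := (h.merge h1 h4 e1).merge h2 h3 e2
      simp only [badL_sound hi hf, ih _ hi, Bool.or_false]

/-- Number of the edge `v, nx v`. -/
def em (v : Fin 34) : ℕ := bif Nat.ble 17 v.val then v.val + 2 else v.val

/-- The edge with a given number (`none` for the separator). -/
def me (n : ℕ) : Option (Fin 34) :=
  bif Nat.beq n 18 then none
  else bif Nat.beq n 17 then some 0
  else bif Nat.beq n 36 then some 17
  else bif Nat.ble 19 n then some (Fin.ofNat 34 (n - 2))
  else some (Fin.ofNat 34 n)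

theorem me_em : ∀ v, me (em v) = some v := by decide
theorem em_lt : ∀ v, em v < 37 := by decide
theorem me_succ : ∀ p : Fin 36, (me p.val = none ∧ me (p.val + 1) ≠ none) ∨
    (me p.val ≠ none ∧ me (p.val + 1) = none) ∨
    ∃ v, me p.val = some (pv v) ∧ me (p.val + 1) = some v := by decide +kernel
theorem me_init : ∀ p : Fin 37, me (initL.getD p.val 0) = me p.val := by decide +kernel

theorem spokeList_spec : ∀ q ∈ spokeList, ∃ v : Fin 34,
    q.1 = em (pv v) ∧ q.2.1 = em v ∧ q.2.2.1 = em (pv (sp v)) ∧ q.2.2.2 = em (sp v) := by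
  decide +kernel

/-- There is no admissible labelling of the cycle edges. -/
theorem no_labelling {α : Type*} (f : Fin 34 → α) (h1 : ∀ v, f (pv v) ≠ f v)
    (h2 : ∀ v, (f (pv v) = f (pv (sp v)) ∧ f v = f (sp v)) ∨
      (f (pv v) = f (sp v) ∧ f v = f (pv (sp v)))) : False := by
  let g : ℕ → Option α := fun n => (me n).map f
  have hg : ∀ v : Fin 34, g (em v) = some (f v) := fun v => by
    simp [g, me_em]
  have key : refute spokeList initL = false := by
    apply refute_sound (f := g)
    · intro p hp
      rcases me_succ ⟨p, hp⟩ with ⟨a, b⟩ | ⟨a, b⟩ | ⟨v, a, b⟩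
      · simp only at a b
        simp only [g, a, Option.map_none]
        intro hh
        exact b (Option.map_eq_none_iff.1 hh.symm)
      · simp only at a b
        simp only [g, b, Option.map_none]
        intro hh
        exact a (Option.map_eq_none_iff.1 hh)
      · simp only at a b
        simp only [g, a, b, Option.map_some]
        intro hh
        exact h1 v (Option.some.inj hh)
    · intro q hq
      obtain ⟨v, e1, e2, e3, e4⟩ := spokeList_spec q hq
      rw [e1, e2, e3, e4]
      exact ⟨em_lt _, em_lt _, em_lt _, em_lt _⟩
    · intro q hq
      obtain ⟨v, e1, e2, e3, e4⟩ := spokeList_spec q hq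
      rw [e1, e2, e3, e4, hg, hg, hg, hg]
      simpa using h2 v
    · exact ⟨rfl, fun p hp => congrArg (Option.map f) (me_init ⟨p, hp⟩)⟩
  rw [refute_true] at key
  exact Bool.noConfusion key

/-! ### Uncolourability -/

theorem fin3_pairs : ∀ a b c d s : Fin 3, a ≠ b → a ≠ s → b ≠ s → c ≠ d → c ≠ s → d ≠ s →
    (a = c ∧ b = d) ∨ (a = d ∧ b = c) := by decide

theorem snk_uncolourable : ¬ Colourable3 snk := by
  rintro ⟨c, hc⟩
  have hR : ∀ v, s(v, nx v) ∈ snk.edgeSet := fun v => Or.inl rfl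
  have hS : ∀ v, s(v, sp v) ∈ snk.edgeSet := fun v => Or.inr (Or.inr rfl)
  have hm : ∀ v, v ∈ s(pv v, nx (pv v)) := fun v => by
    rw [nx_pv]; exact Sym2.mem_mk_right _ _
  have d1 : ∀ v, c s(pv v, nx (pv v)) ≠ c s(v, nx v) := fun v => by
    refine hc _ (hR _) _ (hR _) ?_ ⟨v, hm v, Sym2.mem_mk_left _ _⟩
    rw [nx_pv, Sym2.eq_swap]
    intro h
    exact nx_ne_pv v (Sym2.congr_right.1 h).symm
  have d2 : ∀ v, c s(pv v, nx (pv v)) ≠ c s(v, sp v) := fun v => by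
    refine hc _ (hR _) _ (hS _) ?_ ⟨v, hm v, Sym2.mem_mk_left _ _⟩
    rw [nx_pv, Sym2.eq_swap]
    intro h
    exact pv_ne_sp v (Sym2.congr_right.1 h)
  have d3 : ∀ v, c s(v, nx v) ≠ c s(v, sp v) := fun v => by
    refine hc _ (hR _) _ (hS _) ?_ ⟨v, Sym2.mem_mk_left _ _, Sym2.mem_mk_left _ _⟩
    intro h
    exact nx_ne_sp v (Sym2.congr_right.1 h)
  refine no_labelling (fun v => c s(v, nx v)) d1 fun v => ?_
  have e : s(sp v, sp (sp v)) = s(v, sp v) := by rw [sp_sp, Sym2.eq_swap]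
  have dd2 := d2 (sp v)
  have dd3 := d3 (sp v)
  rw [e] at dd2 dd3
  exact fin3_pairs _ _ _ _ _ (d1 v) (d2 v) (d3 v) (d1 (sp v)) dd2 dd3

/-! ### Local structure of cycles -/

theorem two_reg_local {C : snk.Subgraph} (hC : IsTwoRegular C) (v : Fin 34) :
    ¬ (C.Adj v (nx v) ∧ C.Adj v (pv v) ∧ C.Adj v (sp v)) ∧
    (C.Adj v (nx v) → C.Adj v (pv v) ∨ C.Adj v (sp v)) ∧
    (C.Adj v (pv v) → C.Adj v (nx v) ∨ C.Adj v (sp v)) ∧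
    (C.Adj v (sp v) → C.Adj v (nx v) ∨ C.Adj v (pv v)) := by
  have sub : ∀ w, C.Adj v w → w = nx v ∨ w = pv v ∨ w = sp v := fun w h => C.adj_sub h
  have one : ∀ w, C.Adj v w → (∀ u, C.Adj v u → u = w) → False := fun w h hu => by
    have h2 := hC v (C.edge_vert h)
    have : C.neighborSet v = {w} := by
      ext u
      exact ⟨fun k => hu u k, fun k => by rw [Set.mem_singleton_iff.1 k]; exact h⟩
    rw [this, Set.ncard_singleton] at h2
    omega
  refine ⟨?_, ?_, ?_, ?_⟩
  · rintro ⟨a, b, c⟩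
    have h2 := hC v (C.edge_vert a)
    have : C.neighborSet v = {nx v, pv v, sp v} := by
      ext u
      constructor
      · exact fun k => sub u k
      · rintro (k | k | k)
        · rw [k]; exact a
        · rw [k]; exact b
        · rw [k]; exact c
    rw [this, ncard_three (nx_ne_pv v) (nx_ne_sp v) (pv_ne_sp v)] at h2
    omega
  · intro a
    by_contra hn
    push Not at hn
    refine one _ a fun u hu => ?_
    rcases sub u hu with k | k | k
    · exact k
    · exact absurd (k ▸ hu) hn.1
    · exact absurd (k ▸ hu) hn.2
  · intro a
    by_contra hn
    push Not at hn
    refine one _ a fun u hu => ?_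
    rcases sub u hu with k | k | k
    · exact absurd (k ▸ hu) hn.1
    · exact k
    · exact absurd (k ▸ hu) hn.2
  · intro a
    by_contra hn
    push Not at hn
    refine one _ a fun u hu => ?_
    rcases sub u hu with k | k | k
    · exact absurd (k ▸ hu) hn.1
    · exact absurd (k ▸ hu) hn.2
    · exact k

/-! ### The 2-factor and its two cycles -/

/-- The 2-factor. -/
def fac : snk.Subgraph where
  verts := Set.univ
  Adj a b := b = nx a ∨ b = pv a
  adj_sub := by
    rintro a b (h | h)
    · exact Or.inl h
    · exact Or.inr (Or.inl h)
  edge_vert := fun _ => Set.mem_univ _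
  symm := ⟨by
    rintro a b (h | h)
    · right; rw [h, pv_nx]
    · left; rw [h, nx_pv]⟩

/-- Which of the two cycles a vertex lies on. -/
def side (v : Fin 34) : Bool := Nat.ble 17 v.val

theorem side_nx : ∀ v, side (nx v) = side v := by decide
theorem side_pv : ∀ v, side (pv v) = side v := by decide

/-- The two cycles of the 2-factor. -/
def cyc (p : Bool) : snk.Subgraph where
  verts := {v | side v = p}
  Adj a b := side a = p ∧ (b = nx a ∨ b = pv a)
  adj_sub := by
    rintro a b ⟨-, h | h⟩
    · exact Or.inl h
    · exact Or.inr (Or.inl h)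
  edge_vert := fun h => h.1
  symm := ⟨by
    rintro a b ⟨hp, h | h⟩
    · exact ⟨by rw [h, side_nx, hp], by right; rw [h, pv_nx]⟩
    · exact ⟨by rw [h, side_pv, hp], by left; rw [h, nx_pv]⟩⟩

theorem fac_two_factor : IsTwoFactor fac := by
  refine ⟨fun v => Set.mem_univ v, fun v _ => ?_⟩
  have : fac.neighborSet v = {nx v, pv v} := by
    ext w; rfl
  rw [this, Set.ncard_pair (nx_ne_pv v)]

theorem cyc_le (p : Bool) : cyc p ≤ fac :=
  ⟨fun _ _ => Set.mem_univ _, fun _ _ h => h.2⟩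

/-- Base vertices of the two cycles. -/
def base (p : Bool) : Fin 34 := bif p then 17 else 0

theorem iter_cover : ∀ v : Fin 34, ∃ k : Fin 17, nx^[k.val] (base (side v)) = v := by
  decide +kernel

theorem side_base : ∀ p, side (base p) = p := by decide

theorem side_iter (p : Bool) (k : ℕ) : side (nx^[k] (base p)) = p := by
  induction k with
  | zero => exact side_base p
  | succ k ih => rw [Function.iterate_succ_apply', side_nx, ih]

theorem cyc_isCycle (p : Bool) : IsCycleSub (cyc p) := by
  constructor
  · have reach : ∀ k : ℕ, (cyc p).coe.Reachable ⟨base p, side_base p⟩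
        ⟨nx^[k] (base p), side_iter p k⟩ := by
      intro k
      induction k with
      | zero => exact SimpleGraph.Reachable.refl _
      | succ k ih =>
        refine ih.trans (SimpleGraph.Adj.reachable ?_)
        show (cyc p).Adj _ _
        exact ⟨side_iter p k, Or.inl (Function.iterate_succ_apply' ..)⟩
    have r2 : ∀ v : (cyc p).verts, (cyc p).coe.Reachable ⟨base p, side_base p⟩ v := by
      rintro ⟨v, hv⟩
      obtain ⟨k, hk⟩ := iter_cover v
      have hv' : side v = p := hv
      rw [hv'] at hk
      have := reach k.val
      convert this using 1
      exact Subtype.ext hk.symm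
    refine ⟨?_⟩
    have : Nonempty (cyc p).verts := ⟨⟨base p, side_base p⟩⟩
    exact ⟨fun a b => (r2 a).symm.trans (r2 b)⟩
  · intro v hv
    have : (cyc p).neighborSet v = {nx v, pv v} := by
      ext w
      exact ⟨fun h => h.2, fun h => ⟨hv, h⟩⟩
    rw [this, Set.ncard_pair (nx_ne_pv v)]

theorem cyc_ne : cyc true ≠ cyc false := by
  intro h
  have h2 : (17 : Fin 34) ∈ (cyc true).verts := by
    show side 17 = true
    decide
  rw [h] at h2
  have h3 : side 17 = false := h2
  exact absurd h3 (by decide)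

/-! ### No CDC contains the 2-factor -/

theorem not_in_cdc : ¬ ∃ D : Multiset snk.Subgraph, IsCDC snk D ∧
    ∀ C : snk.Subgraph, C ≤ fac → IsCycleSub C → C ∈ D := by
  rintro ⟨D, ⟨hcyc, hcov⟩, hF⟩
  obtain ⟨D1, rfl⟩ := Multiset.exists_cons_of_mem (hF _ (cyc_le true) (cyc_isCycle true))
  have h2 := hF _ (cyc_le false) (cyc_isCycle false)
  rw [Multiset.mem_cons] at h2
  obtain ⟨E, rfl⟩ := Multiset.exists_cons_of_mem (h2.resolve_left cyc_ne.symm)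
  have hreg : ∀ C ∈ E, IsTwoRegular C := fun C hC =>
    (hcyc C (Multiset.mem_cons_of_mem (Multiset.mem_cons_of_mem hC))).2
  have hR : ∀ v, E.countP (fun C => s(v, nx v) ∈ C.edgeSet) = 1 := by
    intro v
    have h := hcov s(v, nx v) (Or.inl rfl)
    rw [Multiset.countP_cons, Multiset.countP_cons] at h
    have ht : ∀ p, s(v, nx v) ∈ (cyc p).edgeSet ↔ side v = p := fun p =>
      ⟨fun h => h.1, fun h => ⟨h, Or.inl rfl⟩⟩
    rw [ht, ht] at h
    cases hs : side v <;> simpa [hs] using h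
  have hS : ∀ v, ∃ C ∈ E, C.Adj v (sp v) := by
    intro v
    have h := hcov s(v, sp v) (Or.inr (Or.inr rfl))
    rw [Multiset.countP_cons, Multiset.countP_cons] at h
    have ht : ∀ p, ¬ s(v, sp v) ∈ (cyc p).edgeSet := by
      rintro p ⟨-, h | h⟩
      · exact nx_ne_sp v h.symm
      · exact pv_ne_sp v h.symm
    rw [if_neg (ht _), if_neg (ht _)] at h
    obtain ⟨C, hC, hC'⟩ := Multiset.countP_pos.1 (show 0 < E.countP (fun C => s(v, sp v) ∈ C.edgeSet) by omega)
    exact ⟨C, hC, hC'⟩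
  have hex : ∀ v, ∃ K : snk.Subgraph, ∀ C, (C ∈ E ∧ C.Adj v (nx v)) ↔ C = K := by
    intro v
    have h := hR v
    rw [Multiset.countP_eq_card_filter, Multiset.card_eq_one] at h
    obtain ⟨K, hK⟩ := h
    refine ⟨K, fun C => ?_⟩
    rw [← Multiset.mem_singleton, ← hK, Multiset.mem_filter]
    rfl
  choose K hK using hex
  have kE : ∀ v, K v ∈ E := fun v => ((hK v _).2 rfl).1
  have kR : ∀ v, (K v).Adj v (nx v) := fun v => ((hK v _).2 rfl).2
  have kL : ∀ v, (K (pv v)).Adj v (pv v) := fun v => by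
    have := (kR (pv v)).symm
    rwa [nx_pv] at this
  have uR : ∀ v, ∀ C ∈ E, C.Adj v (nx v) → C = K v := fun v C hC h => (hK v C).1 ⟨hC, h⟩
  have uL : ∀ v, ∀ C ∈ E, C.Adj v (pv v) → C = K (pv v) := fun v C hC h =>
    (hK (pv v) C).1 ⟨hC, by rw [nx_pv]; exact h.symm⟩
  have hne : ∀ v, K (pv v) ≠ K v := by
    intro v he
    obtain ⟨C, hC, hs⟩ := hS v
    have hl := two_reg_local (hreg C hC) v
    have hCK : C = K v := by
      rcases hl.2.2.2 hs with h | h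
      · exact uR v C hC h
      · rw [← he]; exact uL v C hC h
    apply hl.1
    refine ⟨?_, ?_, hs⟩
    · rw [hCK]; exact kR v
    · rw [hCK, ← he]; exact kL v
  have sR : ∀ v, (K v).Adj v (sp v) := fun v => by
    rcases (two_reg_local (hreg _ (kE v)) v).2.1 (kR v) with h | h
    · exact absurd (uL v _ (kE v) h).symm (hne v)
    · exact h
  have sL : ∀ v, (K (pv v)).Adj v (sp v) := fun v => by
    rcases (two_reg_local (hreg _ (kE (pv v))) v).2.2.1 (kL v) with h | h
    · exact absurd (uR v _ (kE _) h) (hne v)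
    · exact h
  have alt : ∀ v, ∀ C ∈ E, C.Adj v (sp v) → C = K (pv (sp v)) ∨ C = K (sp v) := by
    intro v C hC h
    have h' : C.Adj (sp v) (sp (sp v)) := by rw [sp_sp]; exact h.symm
    rcases (two_reg_local (hreg C hC) (sp v)).2.2.2 h' with k | k
    · exact Or.inr (uR _ C hC k)
    · exact Or.inl (uL _ C hC k)
  refine no_labelling K hne fun v => ?_
  rcases alt v _ (kE _) (sL v) with a | a <;> rcases alt v _ (kE _) (sR v) with b | b
  · exact absurd (a.trans b.symm) (hne v)
  · exact Or.inl ⟨a, b⟩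
  · exact Or.inr ⟨a, b⟩
  · exact absurd (a.trans b.symm) (hne v)

/-! ### Cyclic connectivity -/

/-- Membership test. -/
def memL (v : ℕ) : List ℕ → Bool
  | [] => false
  | a :: l => Nat.beq a v || memL v l

theorem memL_iff (v : ℕ) (l : List ℕ) : memL v l = true ↔ v ∈ l := by
  induction l with
  | nil => simp [memL]
  | cons a l ih =>
    rw [memL, Bool.or_eq_true, ih, List.mem_cons, Nat.beq_eq]
    exact or_congr_left eq_comm

/-- Number of elements of the first list in the second one. -/
def cntL (T : List ℕ) : List ℕ → ℕ
  | [] => 0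
  | a :: l => bif memL a T then cntL T l + 1 else cntL T l

/-- The list has at most two elements. -/
def small2 : List ℕ → Bool
  | [] => true
  | [_] => true
  | [_, _] => true
  | _ => false

/-- Search through all vertex sets with at most `b` more cut edges. -/
def cutSearch : List (ℕ × List ℕ) → List ℕ → List ℕ → ℕ → Bool
  | [], T, F, _ =>
    (small2 T || small2 F) && (List.range 34).all fun v => memL v T || memL v F
  | (v, ns) :: t, T, F, b =>
    (let k := cntL F ns
     bif Nat.ble k b then cutSearch t (v :: T) F (b - k) else true) &&
    (let k := cntL T ns
     bif Nat.ble k b then cutSearch t T (v :: F) (b - k) else true)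

theorem cutSearch_true : cutSearch stepList [] [] 4 = true := by decide +kernel

/-- Number of cut edges of `f` in the list of steps. -/
def cost (f : ℕ → Bool) : List (ℕ × List ℕ) → ℕ
  | [] => 0
  | (v, ns) :: t => ns.countP (fun u => f u != f v) + cost f t

theorem cntL_le (f : ℕ → Bool) (x : Bool) (T : List ℕ) (hT : ∀ u ∈ T, f u = !x) (ns : List ℕ) :
    cntL T ns ≤ ns.countP (fun u => f u != x) := by
  induction ns with
  | nil => simp [cntL]
  | cons a l ih =>
    rw [cntL, List.countP_cons]
    cases h : memL a T
    · rw [cond_false]; omega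
    · have := hT a ((memL_iff _ _).1 h)
      rw [this]
      simp
      omega

theorem small2_iff (l : List ℕ) (h : small2 l = true) : l.length ≤ 2 := by
  match l, h with
  | [], _ => simp
  | [_], _ => simp
  | [_, _], _ => simp

theorem cutSearch_sound (f : ℕ → Bool) (t : List (ℕ × List ℕ)) (T F : List ℕ) (b : ℕ)
    (h : cutSearch t T F b = true) (hT : ∀ u ∈ T, f u = true) (hF : ∀ u ∈ F, f u = false)
    (hc : cost f t ≤ b) :
    ∃ l : List ℕ, l.length ≤ 2 ∧ ∃ x, ∀ v < 34, f v = x → v ∈ l := by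
  induction t generalizing T F b with
  | nil =>
    rw [cutSearch, Bool.and_eq_true, Bool.or_eq_true, List.all_eq_true] at h
    obtain ⟨h1, h2⟩ := h
    have h3 : ∀ v < 34, v ∈ T ∨ v ∈ F := fun v hv => by
      have := h2 v (List.mem_range.2 hv)
      rwa [Bool.or_eq_true, memL_iff, memL_iff] at this
    rcases h1 with h1 | h1
    · refine ⟨T, small2_iff _ h1, true, fun v hv hfv => ?_⟩
      rcases h3 v hv with k | k
      · exact k
      · rw [hF v k] at hfv; exact Bool.noConfusion hfv
    · refine ⟨F, small2_iff _ h1, false, fun v hv hfv => ?_⟩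
      rcases h3 v hv with k | k
      · rw [hT v k] at hfv; exact Bool.noConfusion hfv
      · exact k
  | cons q t ih =>
    obtain ⟨v, ns⟩ := q
    rw [cutSearch, Bool.and_eq_true] at h
    rw [cost] at hc
    cases hv : f v
    · rw [hv] at hc
      have hle := cntL_le f false T (by simpa using hT) ns
      have h' := h.2
      have hb : Nat.ble (cntL T ns) b = true := Nat.ble_eq_true_of_le (by omega)
      simp only [hb, cond_true] at h'
      refine ih _ _ _ h' hT ?_ (by omega)
      intro u hu
      rcases List.mem_cons.1 hu with k | k
      · rw [k, hv]
      · exact hF u k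
    · rw [hv] at hc
      have hle := cntL_le f true F (by simpa using hF) ns
      have h' := h.1
      have hb : Nat.ble (cntL F ns) b = true := Nat.ble_eq_true_of_le (by omega)
      simp only [hb, cond_true] at h'
      refine ih _ _ _ h' ?_ hF (by omega)
      intro u hu
      rcases List.mem_cons.1 hu with k | k
      · rw [k, hv]
      · exact hT u k

/-- All edges, as ordered pairs. -/
def edgeL : List (ℕ × ℕ) := stepList.flatMap fun q => q.2.map fun u => (q.1, u)

theorem cost_eq (f : ℕ → Bool) (t : List (ℕ × List ℕ)) :
    cost f t = (t.flatMap fun q => q.2.map fun u => (q.1, u)).countP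
      (fun p => f p.2 != f p.1) := by
  induction t with
  | nil => rfl
  | cons q t ih =>
    obtain ⟨v, ns⟩ := q
    rw [cost, List.flatMap_cons, List.countP_append, List.countP_map, ih]
    rfl

/-- Pair of natural numbers to an unordered pair of vertices. -/
def toE (p : ℕ × ℕ) : Sym2 (Fin 34) := s(Fin.ofNat 34 p.1, Fin.ofNat 34 p.2)

theorem edgeL_nodup : (edgeL.map toE).Nodup := by decide +kernel

theorem edgeL_edge : ∀ p ∈ edgeL, Fin.ofNat 34 p.2 = nx (Fin.ofNat 34 p.1) ∨
    Fin.ofNat 34 p.2 = pv (Fin.ofNat 34 p.1) ∨ Fin.ofNat 34 p.2 = sp (Fin.ofNat 34 p.1) := by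
  decide +kernel

theorem cost_le_cut (A : Set (Fin 34)) :
    cost (fun n => decide (Fin.ofNat 34 n ∈ A)) stepList ≤ (cutEdges snk A).ncard := by
  rw [cost_eq, List.countP_eq_length_filter]
  change (edgeL.filter _).length ≤ _
  set L := edgeL.filter
    (fun p => decide (Fin.ofNat 34 p.2 ∈ A) != decide (Fin.ofNat 34 p.1 ∈ A)) with hL
  have nd : (L.map toE).Nodup := edgeL_nodup.sublist (List.filter_sublist.map toE)
  rw [← List.length_map (f := toE), ← List.toFinset_card_of_nodup nd, ← Set.ncard_coe_finset]
  refine Set.ncard_le_ncard ?_ (Set.toFinite _)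
  intro e he
  rw [List.coe_toFinset, Set.mem_ofPred_eq, List.mem_map] at he
  obtain ⟨p, hp, rfl⟩ := he
  rw [hL, List.mem_filter] at hp
  obtain ⟨hp1, hp2⟩ := hp
  refine ⟨edgeL_edge p hp1, ?_⟩
  by_cases h1 : Fin.ofNat 34 p.1 ∈ A
  · by_cases h2 : Fin.ofNat 34 p.2 ∈ A
    · rw [decide_eq_true h1, decide_eq_true h2] at hp2; exact Bool.noConfusion hp2
    · exact ⟨_, h1, _, h2, rfl⟩
  · by_cases h2 : Fin.ofNat 34 p.2 ∈ A
    · exact ⟨_, h2, _, h1, Sym2.eq_swap⟩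
    · rw [decide_eq_false h1, decide_eq_false h2] at hp2; exact Bool.noConfusion hp2

theorem not_small_cycle {A : Set (Fin 34)} (h : HasCycleIn snk A) (l : List ℕ)
    (hl : l.length ≤ 2) (hA : ∀ v ∈ A, v.val ∈ l) : False := by
  obtain ⟨C, ⟨hc, hr⟩, hCA⟩ := h
  obtain ⟨v, hv⟩ := hc.nonempty
  have h2 := hr v hv
  have hvn : v ∉ C.neighborSet v := fun h => C.loopless.irrefl v h
  have h3 : (insert v (C.neighborSet v)).ncard = 3 := by
    rw [Set.ncard_insert_of_notMem hvn, h2]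
  have hsub : Fin.val '' (insert v (C.neighborSet v)) ⊆ (l.toFinset : Set ℕ) := by
    rintro _ ⟨w, hw, rfl⟩
    rw [List.coe_toFinset]
    rcases hw with rfl | hw
    · exact hA _ (hCA hv)
    · exact hA _ (hCA (C.edge_vert (SimpleGraph.Subgraph.Adj.symm hw)))
  have h4 := Set.ncard_le_ncard hsub (Set.toFinite _)
  rw [Set.ncard_image_of_injective _ Fin.val_injective, h3, Set.ncard_coe_finset] at h4
  have := l.toFinset_card_le
  omega

theorem snk_cyc5 : CyclEdgeConn snk 5 := by
  intro A h1 h2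
  by_contra hlt
  have hc := cost_le_cut A
  obtain ⟨l, hl, x, hx⟩ := cutSearch_sound (fun n => decide (Fin.ofNat 34 n ∈ A)) stepList [] [] 4
    cutSearch_true (by simp) (by simp) (by omega)
  cases x
  · refine not_small_cycle h2 l hl fun v hv => hx v.val v.isLt ?_
    have : v ∉ A := hv
    simpa using this
  · refine not_small_cycle h1 l hl fun v hv => hx v.val v.isLt ?_
    simpa using hv

/-! ### Girth -/

/-- The neighbours of a vertex. -/
def nbL (v : Fin 34) : List (Fin 34) := [nx v, pv v, sp v]

theorem mem_nbL {a b : Fin 34} (h : snk.Adj a b) : b ∈ nbL a := by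
  rcases h with h | h | h <;> simp [nbL, h]

theorem no_tri_s15 : ∀ a, ∀ b ∈ nbL a, ∀ c ∈ nbL b, a ∉ nbL c := by decide +kernel

theorem no_quad : ∀ a, ∀ b ∈ nbL a, ∀ c ∈ nbL b, ∀ d ∈ nbL c, a ∈ nbL d → c = a ∨ d = b := by
  decide +kernel

theorem cycle_len {a : Fin 34} (w : snk.Walk a a) (hw : w.IsCycle) : 5 ≤ w.length := by
  have h3 := hw.three_le_length
  by_contra hlt
  match w, hw with
  | .nil, hw => simp at h3
  | .cons h (.nil), hw => simp at h3
  | .cons h (.cons k2 .nil), hw => simp at h3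
  | .cons h (.cons k2 (.cons k3 .nil)), hw =>
    exact no_tri_s15 _ _ (mem_nbL h) _ (mem_nbL k2) (mem_nbL k3)
  | .cons (v := b) h (.cons (v := c) k2 (.cons (v := d) k3 (.cons k4 .nil))), hw =>
    have nd := hw.support_nodup
    simp at nd
    rcases no_quad _ _ (mem_nbL h) _ (mem_nbL k2) _ (mem_nbL k3) (mem_nbL k4) with k | k
    · grind
    · grind
  | .cons h (.cons k2 (.cons k3 (.cons k4 (.cons h4 w)))), hw =>
    simp at hlt

theorem snk_not_acyclic : ¬ snk.IsAcyclic := by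
  intro h
  have h1 : snk.Adj 2 3 := Or.inl (by decide)
  have h2 : snk.Adj 3 4 := Or.inl (by decide)
  have h3 : snk.Adj 4 26 := Or.inr (Or.inr (by decide))
  have h4 : snk.Adj 26 27 := Or.inl (by decide)
  have h5 : snk.Adj 27 2 := Or.inr (Or.inr (by decide))
  refine h (.cons h1 (.cons h2 (.cons h3 (.cons h4 (.cons h5 .nil))))) ?_
  rw [SimpleGraph.Walk.cons_isCycle_iff, SimpleGraph.Walk.isPath_def]
  simp

theorem snk_girth : 5 ≤ snk.girth := by
  have h0 : snk.girth ≠ 0 := fun h => snk_not_acyclic (SimpleGraph.girth_eq_zero.1 h)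
  obtain ⟨a, w, hw, hl⟩ := SimpleGraph.exists_girth_eq_length.2 snk_not_acyclic
  rw [hl]
  exact cycle_len w hw

/-- there exists a cyclically 5-edge-connected snark on 34 vertices with a
2-factor not contained in any CDC (refuting Jackson's conjecture). -/
theorem exists_cyc5_snark_34_two_factor_not_in_cdc :
    ∃ G : SimpleGraph (Fin 34), IsSnark G ∧ CyclEdgeConn G 5 ∧
      ∃ F : G.Subgraph, IsTwoFactor F ∧
        ¬ ∃ D : Multiset G.Subgraph, IsCDC G D ∧
          ∀ C : G.Subgraph, C ≤ F → IsCycleSub C → C ∈ D := by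
  refine ⟨snk, ⟨snk_cubic, snk_uncolourable, ?_, snk_girth⟩, snk_cyc5, fac, fac_two_factor,
    not_in_cdc⟩
  intro A h1 h2
  exact le_trans (by norm_num) (snk_cyc5 A h1 h2)

end SnarkPaper
end
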